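/- (Four-graviton celestial bracket identity) Let f₁, f₂, f₃, f₄ : ℝ → ℂ be Schwartz functions, let β₁, β₂, β₄ > 0 and c ∈ (0,2). Then (1/(2π))³ ∫_ℝ ∫_ℝ ∫_ℝ β₁^{c+2+iλ₁} β₂^{c+2+iλ₂} β₄^{c−3+iλ₄} · M(f₁)(2−c−iλ₁) · M(f₂)(2−c−iλ₂) · M(f₄)(2−c−iλ₄) · M(f₃)(3c+i(λ₁+λ₂+λ₄)) dλ₁ dλ₂ dλ₄ = (β₁⁴ β₂⁴ / β₄) ∫₀^∞ ω⁵ f₁(β₁ω) f₂(β₂ω) f₃(ω) f₄(β₄ω) dω, where M(h)(s) = ∫₀^∞ h(ω) ω^{s−1} dω, and all integrals converge absolutely. -/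

import Mathlib

open MeasureTheory Complex Set

open Filter Topology Asymptotics in
lemma aux_isBigO_top (f : SchwartzMap ℝ ℂ) (a : ℝ) : (f : ℝ → ℂ) =O[atTop] (fun x : ℝ => x ^ (-a)) := by
  have h := (f.isBigO_cocompact_rpow (-a)).mono (atTop_le_cocompact)
  refine h.trans (IsBigO.of_bound 1 ?_)
  filter_upwards [eventually_gt_atTop 0] with x hx
  simp [abs_of_pos hx]

open Filter Topology Asymptotics in
lemma aux_isBigO_zero (f : SchwartzMap ℝ ℂ) : (f : ℝ → ℂ) =O[𝓝[>] 0] (fun x : ℝ => x ^ (-(0:ℝ))) := by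
  simp only [neg_zero, Real.rpow_zero]
  exact (f.continuous.continuousAt.tendsto.isBigO_one ℝ).mono nhdsWithin_le_nhds

lemma aux_conv (f : SchwartzMap ℝ ℂ) {s : ℂ} (hs : 0 < s.re) : MellinConvergent f s :=
  mellinConvergent_of_isBigO_rpow (a := s.re + 1) (b := 0)
    (f.continuous.locallyIntegrable.locallyIntegrableOn _) (aux_isBigO_top f _) (by linarith)
    (aux_isBigO_zero f) hs

lemma aux_diff (f : SchwartzMap ℝ ℂ) {s : ℂ} (hs : 0 < s.re) : DifferentiableAt ℂ (mellin f) s :=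
  mellin_differentiableAt_of_isBigO_rpow (a := s.re + 1) (b := 0)
    (f.continuous.locallyIntegrable.locallyIntegrableOn _) (aux_isBigO_top f _) (by linarith)
    (aux_isBigO_zero f) hs

open Filter Topology Asymptotics in
lemma aux_ibp (f : SchwartzMap ℝ ℂ) {s : ℂ} (hs : 0 < s.re) :
    mellin (SchwartzMap.derivCLM ℂ ℂ f) (s + 1) = - (s * mellin f s) := by
  have hs0 : s ≠ 0 := by rintro rfl; simp at hs
  have h1 := aux_conv (SchwartzMap.derivCLM ℂ ℂ f) (s := s + 1) (by simp; linarith)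
  have h2 := aux_conv f hs
  unfold MellinConvergent at h1 h2
  unfold mellin
  simp only [smul_eq_mul, add_sub_cancel_right] at *
  rw [integral_Ioi_mul_deriv_eq_deriv_mul (u := fun x : ℝ => (x : ℂ) ^ s)
    (u' := fun x : ℝ => s * (x : ℂ) ^ (s - 1)) (v := f) (a' := 0) (b' := 0)]
  · simp only [mul_assoc]
    rw [integral_const_mul]; ring
  · intro x hx
    exact hasDerivAt_ofReal_cpow_const (ne_of_gt hx) hs0
  · intro x hx
    rw [SchwartzMap.derivCLM_apply]
    exact f.differentiableAt.hasDerivAt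
  · exact h1
  · have := h2.const_mul s
    refine this.congr (ae_of_all _ fun x => ?_)
    simp [mul_assoc]
  · have : Tendsto (fun x : ℝ => (x : ℂ) ^ s * f x) (𝓝 0) (𝓝 (((0:ℝ) : ℂ) ^ s * f 0)) :=
      ((continuousAt_ofReal_cpow_const 0 s (Or.inl hs)).mul f.continuous.continuousAt).tendsto
    simp only [ofReal_zero, zero_cpow hs0, zero_mul] at this
    exact this.mono_left nhdsWithin_le_nhds
  · have h3 : (fun x : ℝ => (x : ℂ) ^ s * f x) =O[atTop] (fun x : ℝ => x ^ s.re * x ^ (-(s.re + 1))) := by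
      refine IsBigO.mul (IsBigO.of_bound 1 ?_) (aux_isBigO_top f _)
      filter_upwards [eventually_gt_atTop 0] with x hx
      rw [norm_cpow_eq_rpow_re_of_pos hx]
      simp [abs_of_nonneg (Real.rpow_nonneg hx.le _)]
    refine h3.trans_tendsto ?_
    refine tendsto_inv_atTop_zero.congr' ?_
    filter_upwards [eventually_gt_atTop 0] with x hx
    rw [← Real.rpow_add hx]
    simp [Real.rpow_neg_one]

lemma aux_bound (f : SchwartzMap ℝ ℂ) (σ : ℝ) :
    ∃ C : ℝ, ∀ s : ℂ, s.re = σ → ‖mellin f s‖ ≤ C := by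
  refine ⟨∫ t in Ioi (0:ℝ), t ^ (σ - 1) * ‖f t‖, fun s hs => ?_⟩
  unfold mellin
  refine (norm_integral_le_integral_norm _).trans (le_of_eq ?_)
  refine setIntegral_congr_fun measurableSet_Ioi fun t ht => ?_
  simp only [norm_smul]
  rw [norm_cpow_eq_rpow_re_of_pos ht]; simp [hs]

lemma aux_vert (f : SchwartzMap ℝ ℂ) {σ : ℝ} (hσ : 0 < σ) : VerticalIntegrable (mellin f) σ := by
  obtain ⟨C, hC⟩ := aux_bound (SchwartzMap.derivCLM ℂ ℂ (SchwartzMap.derivCLM ℂ ℂ f))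
    (σ + 2)
  have hC0 : 0 ≤ C := (norm_nonneg _).trans (hC (σ + 2 : ℝ) (by simp))
  have hcont : Continuous fun y : ℝ => mellin f (σ + y * I) := by
    rw [continuous_iff_continuousAt]
    intro y
    have h := (aux_diff f (s := σ + y * I) (by simpa)).continuousAt
    exact ContinuousAt.comp (f := fun y : ℝ => (σ + y * I : ℂ)) h (by fun_prop)
  have hi : Integrable fun y : ℝ => C * (1 + 1 / σ ^ 2) * (1 + y ^ 2)⁻¹ :=
    integrable_inv_one_add_sq.const_mul _
  refine hi.mono' hcont.aestronglyMeasurable (ae_of_all _ fun y => ?_)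
  set s : ℂ := σ + y * I with hs
  have hre : s.re = σ := by simp [hs]
  have him : s.im = y := by simp [hs]
  have e1 := aux_ibp f (s := s) (by rw [hre]; exact hσ)
  have e2 := aux_ibp (SchwartzMap.derivCLM ℂ ℂ f) (s := s + 1) (by simp [hre]; linarith)
  rw [e1] at e2
  have e3 := hC (s + 1 + 1) (by simp [hre]; ring)
  rw [e2] at e3
  simp only [norm_neg, norm_mul] at e3
  have n1 : ‖s‖ ^ 2 = σ ^ 2 + y ^ 2 := by
    rw [Complex.sq_norm, normSq_apply, hre, him]; ring
  have n2 : ‖s‖ ≤ ‖s + 1‖ := by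
    rw [← sq_le_sq₀ (norm_nonneg _) (norm_nonneg _), Complex.sq_norm, Complex.sq_norm,
      normSq_apply, normSq_apply]
    simp [hre, him]; nlinarith
  have n3 : (σ ^ 2 + y ^ 2) * ‖mellin f s‖ ≤ C := by
    rw [← n1]
    refine le_trans ?_ e3
    rw [← mul_assoc, sq]
    gcongr
  rw [← div_eq_mul_inv, le_div_iff₀ (by positivity)]
  have n4 : (1 + y ^ 2) ≤ (1 + 1 / σ ^ 2) * (σ ^ 2 + y ^ 2) := by
    have : (1 + 1 / σ ^ 2) * (σ ^ 2 + y ^ 2) = 1 + y ^ 2 + σ ^ 2 + y ^ 2 / σ ^ 2 := by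
      field_simp
      ring
    rw [this]
    have : 0 ≤ y ^ 2 / σ ^ 2 := by positivity
    nlinarith [sq_nonneg σ]
  calc ‖mellin f s‖ * (1 + y ^ 2) ≤ ‖mellin f s‖ * ((1 + 1 / σ ^ 2) * (σ ^ 2 + y ^ 2)) := by gcongr
    _ = (1 + 1 / σ ^ 2) * ((σ ^ 2 + y ^ 2) * ‖mellin f s‖) := by ring
    _ ≤ (1 + 1 / σ ^ 2) * C := by gcongr
    _ = _ := by ring

/-- the one-variable factor -/
noncomputable def auxG (f : SchwartzMap ℝ ℂ) (β c : ℝ) (a : ℂ) (l : ℝ) : ℂ :=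
  (β : ℂ) ^ ((c : ℂ) + a + (l : ℂ) * I) * mellin f ((2 : ℂ) - c - (l : ℂ) * I)

lemma auxG_integrable (f : SchwartzMap ℝ ℂ) {β c : ℝ} (hβ : 0 < β) (a : ℂ) (hc2 : c < 2) :
    Integrable (auxG f β c a) := by
  have h := (aux_vert f (σ := 2 - c) (by linarith)).comp_neg
  unfold auxG
  refine Integrable.bdd_mul (c := β ^ (c + a.re)) ?_ ?_ ?_
  · refine h.congr (ae_of_all _ fun y => ?_)
    simp [sub_eq_add_neg]
  · have : (β : ℂ) ≠ 0 := by exact_mod_cast hβ.ne'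
    have : Continuous fun l : ℝ => (β : ℂ) ^ ((c : ℂ) + a + (l : ℂ) * I) :=
      Continuous.const_cpow (by fun_prop) (Or.inl this)
    exact this.aestronglyMeasurable
  · refine ae_of_all _ fun l => ?_
    rw [norm_cpow_eq_rpow_re_of_pos hβ]; simp

lemma auxG_integral (f : SchwartzMap ℝ ℂ) {β c : ℝ} (hβ : 0 < β) (a : ℂ) (hc2 : c < 2)
    {ω : ℝ} (hω : 0 < ω) :
    ((1 / (2 * Real.pi) : ℝ) : ℂ) * ∫ l : ℝ, auxG f β c a l * (ω : ℂ) ^ ((c : ℂ) + l * I)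
      = (β : ℂ) ^ (a + 2) * (ω : ℂ) ^ 2 * f (β * ω) := by
  have hβ' : (β : ℂ) ≠ 0 := by exact_mod_cast hβ.ne'
  have hω' : (ω : ℂ) ≠ 0 := by exact_mod_cast hω.ne'
  have h := mellinInv_mellin_eq (2 - c) f (mul_pos hβ hω) (aux_conv f (by simp; linarith))
    (aux_vert f (by linarith)) f.continuous.continuousAt
  rw [← h, mellinInv, real_smul, ← integral_neg_eq_self (fun y : ℝ =>
    ((β * ω : ℝ) : ℂ) ^ (-(((2 - c : ℝ) : ℂ) + y * I)) • mellin f (((2 - c : ℝ) : ℂ) + y * I)),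
    mul_left_comm, ← integral_const_mul ((β : ℂ) ^ (a + 2) * (ω : ℂ) ^ 2)]
  congr 1
  refine integral_congr_ae (ae_of_all _ fun l => ?_)
  simp only [auxG, smul_eq_mul]
  push_cast
  rw [mul_cpow_ofReal_nonneg hβ.le hω.le]
  have e1 : (β : ℂ) ^ ((c : ℂ) + a + (l : ℂ) * I)
      = (β : ℂ) ^ (a + 2) * (β : ℂ) ^ (-((2 : ℂ) - c + -l * I)) := by
    rw [← cpow_add _ _ hβ']; congr 1; ring
  have e2 : (ω : ℂ) ^ ((c : ℂ) + (l : ℂ) * I)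
      = (ω : ℂ) ^ 2 * (ω : ℂ) ^ (-((2 : ℂ) - c + -l * I)) := by
    rw [← cpow_ofNat, ← cpow_add _ _ hω']; congr 1; ring
  rw [e1, e2, show (2 : ℂ) - c - l * I = 2 - c + -l * I by ring]
  ring

lemma aux_cpow_split {ω : ℝ} (hω : 0 < ω) (s : ℂ) (l : ℝ) :
    (ω : ℂ) ^ (s + l * I) = (ω : ℂ) ^ s * cexp ((l * Real.log ω : ℝ) * I) := by
  have hω' : (ω : ℂ) ≠ 0 := by exact_mod_cast hω.ne'
  rw [cpow_add _ _ hω', cpow_def_of_ne_zero hω' (l * I), ← ofReal_log hω.le]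
  congr 2; push_cast; ring

lemma auxG_integral' (f : SchwartzMap ℝ ℂ) {β c : ℝ} (hβ : 0 < β) (a : ℂ) (hc2 : c < 2)
    {ω : ℝ} (hω : 0 < ω) :
    ((1 / (2 * Real.pi) : ℝ) : ℂ) *
      ((ω : ℂ) ^ (c : ℂ) * ∫ l : ℝ, auxG f β c a l * cexp ((l * Real.log ω : ℝ) * I))
      = (β : ℂ) ^ (a + 2) * (ω : ℂ) ^ 2 * f (β * ω) := by
  rw [← auxG_integral f hβ a hc2 hω, ← integral_const_mul]
  congr 2
  ext l
  rw [aux_cpow_split hω]; ring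

lemma aux_bdd (f : SchwartzMap ℝ ℂ) (β : ℝ) {g : ℝ → ℂ} {μ : Measure ℝ} (hg : Integrable g μ) :
    Integrable (fun ω => g ω * f (β * ω)) μ := by
  obtain ⟨C, -, hC⟩ := f.decay 0 0
  refine hg.mul_bdd (c := C) ?_ (ae_of_all _ fun x => by simpa using hC (β * x))
  exact (f.continuous.comp (continuous_const_mul β)).aestronglyMeasurable

lemma aux_rhs (f₁ f₂ f₃ f₄ : SchwartzMap ℝ ℂ) (β₁ β₂ β₄ : ℝ) :
    IntegrableOn
        (fun ω : ℝ =>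
          ((ω ^ 5 : ℝ) : ℂ) * f₁ (β₁ * ω) * f₂ (β₂ * ω) * f₃ ω * f₄ (β₄ * ω)) (Ioi 0) := by
  have h := aux_conv f₃ (s := 6) (by simp)
  have h2 := aux_bdd f₄ β₄ (aux_bdd f₂ β₂ (aux_bdd f₁ β₁ h))
  refine h2.congr (ae_of_all _ fun x => ?_)
  have : (x : ℂ) ^ ((6 : ℂ) - 1) = (x : ℂ) ^ 5 := by
    rw [← cpow_ofNat]; congr 1; norm_num
  simp only [smul_eq_mul, this]
  push_cast; ring

lemma aux_main (g₁ g₂ g₄ H : ℝ → ℂ) (h₁ : Integrable g₁) (h₂ : Integrable g₂) (h₄ : Integrable g₄)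
    (hH : IntegrableOn H (Ioi 0)) (F : ℝ → ℝ → ℝ → ℂ)
    (hF : ∀ l₁ l₂ l₄, F l₁ l₂ l₄ = g₁ l₁ * g₂ l₂ * g₄ l₄ *
      ∫ ω in Ioi (0:ℝ), H ω * cexp (((l₁ + l₂ + l₄) * Real.log ω : ℝ) * I)) :
    Integrable (fun p : ℝ × ℝ × ℝ => F p.1 p.2.1 p.2.2) ∧
    (∫ l₁ : ℝ, ∫ l₂ : ℝ, ∫ l₄ : ℝ, F l₁ l₂ l₄) = ∫ ω in Ioi (0:ℝ), H ω *
      ((∫ l : ℝ, g₁ l * cexp ((l * Real.log ω : ℝ) * I)) *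
       ((∫ l : ℝ, g₂ l * cexp ((l * Real.log ω : ℝ) * I)) *
        (∫ l : ℝ, g₄ l * cexp ((l * Real.log ω : ℝ) * I)))) := by
  let K : (ℝ × ℝ × ℝ) × ℝ → ℂ := fun z =>
    ((g₁ z.1.1 * (g₂ z.1.2.1 * g₄ z.1.2.2)) * H z.2) *
      cexp (((z.1.1 + z.1.2.1 + z.1.2.2) * Real.log z.2 : ℝ) * I)
  have hK : Integrable K (volume.prod (volume.restrict (Ioi 0))) := by
    have hG : Integrable (fun p : ℝ × ℝ × ℝ => g₁ p.1 * (g₂ p.2.1 * g₄ p.2.2)) :=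
      h₁.mul_prod (h₂.mul_prod h₄)
    refine (hG.mul_prod hH).mul_bdd (c := 1) ?_ (ae_of_all _ fun z => ?_)
    · refine Measurable.aestronglyMeasurable ?_
      fun_prop
    · rw [norm_exp_ofReal_mul_I]
  have hFK : ∀ p : ℝ × ℝ × ℝ, ∫ ω in Ioi (0:ℝ), K (p, ω) = F p.1 p.2.1 p.2.2 := by
    intro p
    rw [hF, ← integral_const_mul]
    refine integral_congr_ae (ae_of_all _ fun ω => ?_)
    simp only [K]; ring
  have hFi : Integrable (fun p : ℝ × ℝ × ℝ => F p.1 p.2.1 p.2.2) :=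
    hK.integral_prod_left.congr (ae_of_all _ hFK)
  refine ⟨hFi, ?_⟩
  calc (∫ l₁ : ℝ, ∫ l₂ : ℝ, ∫ l₄ : ℝ, F l₁ l₂ l₄)
      = ∫ l₁ : ℝ, ∫ q : ℝ × ℝ, F l₁ q.1 q.2 := by
        refine integral_congr_ae ?_
        filter_upwards [hFi.prod_right_ae] with l₁ hl
        exact (integral_prod _ hl).symm
    _ = ∫ p : ℝ × ℝ × ℝ, F p.1 p.2.1 p.2.2 := (integral_prod _ hFi).symm
    _ = ∫ p : ℝ × ℝ × ℝ, ∫ ω in Ioi (0:ℝ), K (p, ω) := by simp only [hFK]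
    _ = ∫ ω in Ioi (0:ℝ), ∫ p : ℝ × ℝ × ℝ, K (p, ω) := integral_integral_swap hK
    _ = _ := by
        refine integral_congr_ae (ae_of_all _ fun ω => ?_)
        simp only
        rw [← integral_prod_mul, ← integral_prod_mul, ← integral_const_mul]
        refine integral_congr_ae (ae_of_all _ fun p => ?_)
        have : cexp (((p.1 + p.2.1 + p.2.2) * Real.log ω : ℝ) * I) =
            cexp ((p.1 * Real.log ω : ℝ) * I) * (cexp ((p.2.1 * Real.log ω : ℝ) * I) *
              cexp ((p.2.2 * Real.log ω : ℝ) * I)) := by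
          rw [← Complex.exp_add, ← Complex.exp_add]; congr 1; push_cast; ring
        simp only [K, this]
        ring

/-- four-graviton celestial bracket identity: for Schwartz
functions `f₁, f₂, f₃, f₄`, `β₁, β₂, β₄ > 0` and `c ∈ (0,2)`,
`(1/(2π))³ ∭ β₁^{c+2+iλ₁} β₂^{c+2+iλ₂} β₄^{c−3+iλ₄} M(f₁)(2−c−iλ₁)
M(f₂)(2−c−iλ₂) M(f₄)(2−c−iλ₄) M(f₃)(3c+i(λ₁+λ₂+λ₄)) dλ₁ dλ₂ dλ₄
= (β₁⁴ β₂⁴ / β₄) ∫₀^∞ ω⁵ f₁(β₁ω) f₂(β₂ω) f₃(ω) f₄(β₄ω) dω`,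
all integrals converging absolutely. -/
theorem four_graviton_celestial_bracket (f₁ f₂ f₃ f₄ : SchwartzMap ℝ ℂ)
    (β₁ β₂ β₄ : ℝ) (hβ₁ : 0 < β₁) (hβ₂ : 0 < β₂) (hβ₄ : 0 < β₄) (c : ℝ)
    (hc0 : 0 < c) (hc2 : c < 2) :
    let M : (ℝ → ℂ) → ℂ → ℂ := fun h s => ∫ ω in Ioi (0 : ℝ), h ω * (ω : ℂ) ^ (s - 1)
    let F : ℝ → ℝ → ℝ → ℂ := fun l₁ l₂ l₄ =>
      (β₁ : ℂ) ^ ((c : ℂ) + 2 + (l₁ : ℂ) * Complex.I) *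
        (β₂ : ℂ) ^ ((c : ℂ) + 2 + (l₂ : ℂ) * Complex.I) *
        (β₄ : ℂ) ^ ((c : ℂ) - 3 + (l₄ : ℂ) * Complex.I) *
        M f₁ ((2 : ℂ) - c - (l₁ : ℂ) * Complex.I) *
        M f₂ ((2 : ℂ) - c - (l₂ : ℂ) * Complex.I) *
        M f₄ ((2 : ℂ) - c - (l₄ : ℂ) * Complex.I) *
        M f₃ ((3 * c : ℂ) + ((l₁ : ℂ) + (l₂ : ℂ) + (l₄ : ℂ)) * Complex.I)
    Integrable (fun p : ℝ × ℝ × ℝ => F p.1 p.2.1 p.2.2) ∧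
      IntegrableOn
        (fun ω : ℝ =>
          ((ω ^ 5 : ℝ) : ℂ) * f₁ (β₁ * ω) * f₂ (β₂ * ω) * f₃ ω * f₄ (β₄ * ω)) (Ioi 0) ∧
      ((1 / (2 * Real.pi) : ℝ) : ℂ) ^ 3 * (∫ l₁ : ℝ, ∫ l₂ : ℝ, ∫ l₄ : ℝ, F l₁ l₂ l₄) =
        ((β₁ ^ 4 * β₂ ^ 4 / β₄ : ℝ) : ℂ) *
          ∫ ω in Ioi (0 : ℝ),
            ((ω ^ 5 : ℝ) : ℂ) * f₁ (β₁ * ω) * f₂ (β₂ * ω) * f₃ ω * f₄ (β₄ * ω) := by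
  intro M F
  have hM : ∀ (h : ℝ → ℂ) s, M h s = mellin h s := by
    intro h s
    simp only [M, mellin, smul_eq_mul, mul_comm]
  have hHi : IntegrableOn (fun ω : ℝ => (ω : ℂ) ^ ((3 * c : ℂ) - 1) • f₃ ω) (Ioi 0) :=
    aux_conv f₃ (by simpa using hc0)
  obtain ⟨hI, hE⟩ := aux_main (auxG f₁ β₁ c 2) (auxG f₂ β₂ c 2) (auxG f₄ β₄ c (-3))
    (fun ω : ℝ => (ω : ℂ) ^ ((3 * c : ℂ) - 1) • f₃ ω)
    (auxG_integrable f₁ hβ₁ 2 hc2) (auxG_integrable f₂ hβ₂ 2 hc2)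
    (auxG_integrable f₄ hβ₄ (-3) hc2) hHi F (by
      intro l₁ l₂ l₄
      have h3 : M f₃ ((3 * c : ℂ) + ((l₁ : ℂ) + (l₂ : ℂ) + (l₄ : ℂ)) * Complex.I) =
          ∫ ω in Ioi (0:ℝ), ((ω : ℂ) ^ ((3 * c : ℂ) - 1) • f₃ ω) *
            cexp (((l₁ + l₂ + l₄) * Real.log ω : ℝ) * I) := by
        refine setIntegral_congr_fun measurableSet_Ioi fun ω hω => ?_
        have := aux_cpow_split hω ((3 * c : ℂ) - 1) (l₁ + l₂ + l₄)
        simp only [smul_eq_mul]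
        rw [mul_right_comm, ← this, mul_comm]
        congr 2
        push_cast; ring
      rw [← h3]
      simp only [F, hM, auxG, sub_eq_add_neg]
      ring)
  refine ⟨hI, aux_rhs f₁ f₂ f₃ f₄ β₁ β₂ β₄, ?_⟩
  rw [hE, ← integral_const_mul, ← integral_const_mul]
  refine setIntegral_congr_fun measurableSet_Ioi fun ω hω => ?_
  have hω0 : (0 : ℝ) < ω := hω
  have hω' : (ω : ℂ) ≠ 0 := by exact_mod_cast hω0.ne'
  have hb : (β₄ : ℂ) ≠ 0 := by exact_mod_cast hβ₄.ne'
  have k1 := auxG_integral' f₁ hβ₁ 2 hc2 hω0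
  have k2 := auxG_integral' f₂ hβ₂ 2 hc2 hω0
  have k4 := auxG_integral' f₄ hβ₄ (-3) hc2 hω0
  have p1 : ∀ b : ℂ, b ^ ((2 : ℂ) + 2) = b ^ 4 := by
    intro b; rw [← cpow_ofNat]; congr 1; norm_num
  have p4 : (β₄ : ℂ) ^ ((-3 : ℂ) + 2) = (β₄ : ℂ)⁻¹ := by
    rw [← cpow_neg_one]; congr 1; norm_num
  rw [p1] at k1 k2
  rw [p4] at k4
  have e : (ω : ℂ) ^ ((3 * c : ℂ) - 1) =
      (ω : ℂ)⁻¹ * ((ω : ℂ) ^ (c : ℂ) * ((ω : ℂ) ^ (c : ℂ) * (ω : ℂ) ^ (c : ℂ))) := by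
    rw [← cpow_neg_one, ← cpow_add _ _ hω', ← cpow_add _ _ hω', ← cpow_add _ _ hω']
    congr 1; ring
  simp only [smul_eq_mul]
  rw [e]
  generalize (∫ l : ℝ, auxG f₁ β₁ c 2 l * cexp ((l * Real.log ω : ℝ) * I)) = J₁ at *
  generalize (∫ l : ℝ, auxG f₂ β₂ c 2 l * cexp ((l * Real.log ω : ℝ) * I)) = J₂ at *
  generalize (∫ l : ℝ, auxG f₄ β₄ c (-3) l * cexp ((l * Real.log ω : ℝ) * I)) = J₄ at *
  generalize ((1 / (2 * Real.pi) : ℝ) : ℂ) = P at *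
  generalize (ω : ℂ) ^ (c : ℂ) = W at *
  calc _ = (ω : ℂ)⁻¹ * f₃ ω * (P * (W * J₁)) * (P * (W * J₂)) * (P * (W * J₄)) := by ring
    _ = _ := by
      rw [k1, k2, k4]
      push_cast
      field_simp
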